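/- Let k be a field of characteristic zero and let φ = p/q ∈ k(x) be a rational function of degree d ≥ 2 with p, q ∈ k[x] coprime, max(deg p, deg q) = d, and φ′ ≠ 0. Define p_n, q_n recursively by p₁ = p, q₁ = q, p_n = Σ_i a_i p_{n−1}^i q_{n−1}^{d−i}, q_n = Σ_i b_i p_{n−1}^i q_{n−1}^{d−i} (where p = Σ a_i x^i, q = Σ b_i x^i), let K_n be a splitting field of p_n(x) − t q_n(x) over k(t), and let H = Gal(K₁/k(t)). If k is not algebraically closed in K₁, i.e., some element of K₁ not in k is algebraic over k, then for every n ≥ 2 the order of Gal(K_n/k(t)) is strictly less than (#H)^{(dⁿ − 1)/(d − 1)}, the order of the n-fold wreath product [H]ⁿ; in particular Gal(K_n/k(t)) is a proper subgroup of [H]ⁿ. -/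

import Mathlib

open Polynomial

/-- Evaluation of the degree-`d` homogenization of `p` at a pair of polynomials
`(A, B)`: `Σ_i p_i A^i B^{d-i}`. -/
noncomputable def homEvalPoly {k : Type*} [CommRing k] (p : Polynomial k) (d : ℕ)
    (A B : Polynomial k) : Polynomial k :=
  ∑ i ∈ Finset.range (d + 1), Polynomial.C (p.coeff i) * A ^ i * B ^ (d - i)

/-- The pair `(p_n, q_n)` of numerator and denominator of the `n`-th iterate of the
rational function `p/q` of degree `d`: `p₀ = X`, `q₀ = 1`,
`p_n = Σ_i a_i p_{n−1}^i q_{n−1}^{d−i}`, `q_n = Σ_i b_i p_{n−1}^i q_{n−1}^{d−i}`. -/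
noncomputable def iterPQ {k : Type*} [CommRing k] (p q : Polynomial k) (d : ℕ) :
    ℕ → Polynomial k × Polynomial k
  | 0 => (Polynomial.X, 1)
  | n + 1 => (homEvalPoly p d (iterPQ p q d n).1 (iterPQ p q d n).2,
              homEvalPoly q d (iterPQ p q d n).1 (iterPQ p q d n).2)

/-- The polynomial `p_n(x) − t·q_n(x)` over `k(t)`, whose roots are the roots of
`φ^{∘n}(x) = t` for `φ = p/q`. -/
noncomputable def phiIterMinusT {k : Type*} [Field k] (p q : Polynomial k) (d n : ℕ) :
    Polynomial (RatFunc k) :=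
  ((iterPQ p q d n).1).map (algebraMap k (RatFunc k)) -
    Polynomial.C RatFunc.X * ((iterPQ p q d n).2).map (algebraMap k (RatFunc k))


lemma wr_card_gal {F : Type*} [Field F] [CharZero F] (f : F[X]) :
    Nat.card f.Gal = Module.finrank F f.SplittingField := by
  have : Normal F f.SplittingField := Normal.of_isSplittingField f
  have : IsGalois F f.SplittingField := ⟨⟩
  exact IsGalois.card_aut_eq_finrank F f.SplittingField

lemma wr_gal_pos {F : Type*} [Field F] [CharZero F] (f : F[X]) : 0 < Nat.card f.Gal := by
  rw [wr_card_gal]; exact Module.finrank_pos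

lemma wr_gal_map_aux {F E : Type*} [Field F] [Field E] [Algebra F E]
    (f : F[X]) (hf : f ≠ 0) :
    ∃ (ρ : f.SplittingField →ₐ[F] (f.map (algebraMap F E)).SplittingField)
      (r : (f.map (algebraMap F E)).Gal → f.Gal), Function.Injective r ∧
      ∀ σ x, ρ (r σ x) = σ (ρ x) := by
  set T := (f.map (algebraMap F E)).SplittingField with hT
  have hs : (f.map (algebraMap F T)).Splits := by
    have := SplittingField.splits (f.map (algebraMap F E))
    rwa [Polynomial.map_map, ← IsScalarTower.algebraMap_eq] at this
  let ρ : f.SplittingField →ₐ[F] T := SplittingField.lift f hs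
  let _ : Algebra f.SplittingField T := ρ.toRingHom.toAlgebra
  have : IsScalarTower F f.SplittingField T :=
    IsScalarTower.of_algebraMap_eq fun x => (ρ.commutes x).symm
  have : Normal F f.SplittingField := Normal.of_isSplittingField f
  have key : ∀ (σ : T ≃ₐ[E] T) (x : f.SplittingField),
      ρ ((σ.restrictScalars F).restrictNormal f.SplittingField x) = σ (ρ x) := fun σ x =>
    AlgEquiv.restrictNormal_commutes (σ.restrictScalars F) f.SplittingField x
  refine ⟨ρ, fun σ => (AlgEquiv.restrictScalars F (σ : T ≃ₐ[E] T)).restrictNormal f.SplittingField,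
    ?_, key⟩
  intro σ τ h
  refine Gal.ext _ fun x hx => ?_
  have hx' : (f.map (algebraMap F T)).IsRoot x := by
    have := (mem_rootSet.1 hx).2
    simpa [IsRoot, eval_map_algebraMap] using this
  have h1 : f.map (algebraMap F T) = (f.map (algebraMap F f.SplittingField)).map ρ.toRingHom := by
    rw [Polynomial.map_map]; congr 1; ext; simp
  rw [h1] at hx'
  obtain ⟨y, rfl⟩ := (SplittingField.splits f).mem_range_of_isRoot
    ((Polynomial.map_ne_zero_iff (algebraMap F f.SplittingField).injective).2 hf) hx'
  have e1 := key σ y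
  have e2 := key τ y
  have e3 := DFunLike.congr_fun h y
  exact e1.symm.trans ((congrArg ρ e3).trans e2)

lemma wr_gal_map_le {F E : Type*} [Field F] [Field E] [CharZero F]
    (ψ : F →+* E) (f : F[X]) (hf : f ≠ 0) :
    Nat.card (f.map ψ).Gal ≤ Nat.card f.Gal := by
  let _ := ψ.toAlgebra
  obtain ⟨ρ, r, hr, -⟩ := wr_gal_map_aux (E := E) f hf
  have : Finite f.Gal := Nat.finite_of_card_ne_zero (wr_gal_pos f).ne'
  exact Nat.card_le_card_of_injective r hr

lemma wr_gal_map_lt_aux {F E : Type*} [Field F] [Field E] [CharZero F] [Algebra F E]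
    (f : F[X]) (hf : f ≠ 0) (x : f.SplittingField)
    (hx : x ∉ Set.range (algebraMap F f.SplittingField))
    (hsp : ((minpoly F x).map (algebraMap F E)).Splits) :
    Nat.card (f.map (algebraMap F E)).Gal < Nat.card f.Gal := by
  obtain ⟨ρ, r, hr, hc⟩ := wr_gal_map_aux (E := E) f hf
  have : Finite f.Gal := Nat.finite_of_card_ne_zero (wr_gal_pos f).ne'
  have : Normal F f.SplittingField := Normal.of_isSplittingField f
  have : IsGalois F f.SplittingField := ⟨⟩
  refine lt_of_le_of_ne (Nat.card_le_card_of_injective r hr) fun he => hx ?_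
  have hb := (Nat.bijective_iff_injective_and_card r).2 ⟨hr, he⟩
  have hint : IsIntegral F x := IsIntegral.of_finite F x
  have hroot : (((minpoly F x).map (algebraMap F E)).map
      (algebraMap E (f.map (algebraMap F E)).SplittingField)).IsRoot (ρ x) := by
    have h2 : aeval (ρ x) (minpoly F x) = 0 := by
      rw [aeval_algHom_apply, minpoly.aeval, map_zero]
    rw [Polynomial.map_map,
      ← IsScalarTower.algebraMap_eq F E (f.map (algebraMap F E)).SplittingField,
      IsRoot, eval_map_algebraMap]
    exact h2
  obtain ⟨e, he'⟩ := hsp.mem_range_of_isRoot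
    ((Polynomial.map_ne_zero_iff (algebraMap F E).injective).2 (minpoly.ne_zero hint)) hroot
  rw [IsGalois.mem_range_algebraMap_iff_fixed]
  intro τ
  obtain ⟨σ, rfl⟩ := hb.2 τ
  apply ρ.injective
  refine (hc σ x).trans ?_
  change σ (ρ x) = ρ x
  rw [← he']
  exact AlgEquiv.commutes (σ : (f.map (algebraMap F E)).SplittingField ≃ₐ[E] _) e

lemma wr_gal_map_lt {F E : Type*} [Field F] [Field E] [CharZero F]
    (ψ : F →+* E) (f : F[X]) (hf : f ≠ 0) (x : f.SplittingField)
    (hx : x ∉ Set.range (algebraMap F f.SplittingField))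
    (hsp : ((minpoly F x).map ψ).Splits) :
    Nat.card (f.map ψ).Gal < Nat.card f.Gal := by
  let _ := ψ.toAlgebra
  exact wr_gal_map_lt_aux (E := E) f hf x hx hsp

lemma wr_gal_prod_le {E ι : Type*} [Field E] [CharZero E] (s : Finset ι) (f : ι → E[X]) :
    Nat.card (∏ i ∈ s, f i).Gal ≤ ∏ i ∈ s, Nat.card (f i).Gal := by
  classical
  induction s using Finset.induction_on with
  | empty => simp only [Finset.prod_empty]; simp
  | insert a s ha ih =>
    rw [Finset.prod_insert ha, Finset.prod_insert ha]
    have h1 : Finite (f a).Gal := Nat.finite_of_card_ne_zero (wr_gal_pos _).ne'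
    have h2 : Finite (∏ i ∈ s, f i).Gal := Nat.finite_of_card_ne_zero (wr_gal_pos _).ne'
    have := Nat.card_le_card_of_injective _ (Gal.restrictProd_injective (f a) (∏ i ∈ s, f i))
    rw [Nat.card_prod] at this
    exact this.trans (Nat.mul_le_mul_left _ ih)

/-- tower step -/
lemma wr_gal_tower {F E : Type*} [Field F] [Field E] [CharZero F] [CharZero E] [Algebra F E]
    [FiniteDimensional F E]
    (P : F[X]) (Q : E[X]) (hQ : Q ≠ 0)
    (h : ∀ γ : AlgebraicClosure Q.SplittingField, aeval γ P = 0 →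
      eval₂ ((algebraMap Q.SplittingField (AlgebraicClosure Q.SplittingField)).comp
        (algebraMap E Q.SplittingField)) γ Q = 0) :
    Nat.card P.Gal ≤ Module.finrank F E * Nat.card Q.Gal := by
  rw [wr_card_gal, wr_card_gal, Module.finrank_mul_finrank F E Q.SplittingField]
  have hs : (P.map (algebraMap F Q.SplittingField)).Splits := by
    refine Splits.of_splits_map (algebraMap Q.SplittingField (AlgebraicClosure Q.SplittingField))
      (IsAlgClosed.splits _) fun γ hγ => ?_
    have h0 : aeval γ P = 0 := by
      have := (mem_roots'.1 hγ).2
      rw [Polynomial.map_map, ← IsScalarTower.algebraMap_eq] at this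
      simpa [IsRoot, eval_map_algebraMap] using this
    refine (SplittingField.splits Q).mem_range_of_isRoot
      ((Polynomial.map_ne_zero_iff (algebraMap E Q.SplittingField).injective).2 hQ) ?_
    rw [IsRoot, Polynomial.map_map, eval_map]
    exact h γ h0
  have : FiniteDimensional F Q.SplittingField := FiniteDimensional.trans F E Q.SplittingField
  exact LinearMap.finrank_le_finrank_of_injective (f := (SplittingField.lift P hs).toLinearMap)
    (SplittingField.lift P hs).injective

lemma wr_homEval {k L : Type*} [Field k] [Field L] (i : k →+* L) (p : k[X]) (d : ℕ)
    (hp : p.natDegree ≤ d) (A B : k[X]) (γ : L) (hB : eval₂ i γ B ≠ 0) :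
    eval₂ i γ (homEvalPoly p d A B) =
      (eval₂ i γ B) ^ d * eval₂ i (eval₂ i γ A / eval₂ i γ B) p := by
  rw [homEvalPoly, eval₂_finsetSum, eval₂_eq_sum_range' i (Nat.lt_succ_of_le hp), Finset.mul_sum]
  refine Finset.sum_congr rfl fun j hj => ?_
  have hj' : j ≤ d := Nat.lt_succ_iff.1 (Finset.mem_range.1 hj)
  simp only [eval₂_mul, eval₂_pow, eval₂_C, div_pow]
  have : (eval₂ i γ B) ^ d = (eval₂ i γ B) ^ (d - j) * (eval₂ i γ B) ^ j := by
    rw [← pow_add, Nat.sub_add_cancel hj']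
  rw [this]
  field_simp

lemma wr_homEval_zero {k L : Type*} [Field k] [Field L] (i : k →+* L) (p : k[X]) (d : ℕ)
    (A B : k[X]) (γ : L) (hB : eval₂ i γ B = 0) :
    eval₂ i γ (homEvalPoly p d A B) = i (p.coeff d) * (eval₂ i γ A) ^ d := by
  rw [homEvalPoly, eval₂_finsetSum, Finset.sum_eq_single d]
  · simp [eval₂_mul, eval₂_pow]
  · intro j hj hne
    have hj' : j ≤ d := Nat.lt_succ_iff.1 (Finset.mem_range.1 hj)
    have : d - j ≠ 0 := by omega
    simp [eval₂_mul, eval₂_pow, hB, this]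
  · intro h; simp at h

lemma wr_cop {k L : Type*} [Field k] [Field L] (i : k →+* L) (p q : k[X])
    (hcop : IsCoprime p q) (γ : L) : ¬ (eval₂ i γ p = 0 ∧ eval₂ i γ q = 0) := by
  rintro ⟨h1, h2⟩
  obtain ⟨a, b, h⟩ := hcop
  have := congrArg (eval₂ i γ) h
  simp [h1, h2] at this

lemma wr_lead {k : Type*} [Field k] (p q : k[X]) (d : ℕ) (hd : 2 ≤ d)
    (hdeg : max p.natDegree q.natDegree = d) : ¬ (p.coeff d = 0 ∧ q.coeff d = 0) := by
  rintro ⟨h1, h2⟩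
  rcases max_choice p.natDegree q.natDegree with h | h
  · have hp : p.natDegree = d := by omega
    rw [← hp] at h1
    have := leadingCoeff_eq_zero.1 h1
    subst this; simp at hp; omega
  · have hp : q.natDegree = d := by omega
    rw [← hp] at h2
    have := leadingCoeff_eq_zero.1 h2
    subst this; simp at hp; omega

lemma wr_iter_cop {k L : Type*} [Field k] [Field L] (i : k →+* L) (p q : k[X]) (d : ℕ)
    (hd : 2 ≤ d) (hcop : IsCoprime p q) (hdeg : max p.natDegree q.natDegree = d) (n : ℕ) (γ : L) :
    ¬ (eval₂ i γ (iterPQ p q d n).1 = 0 ∧ eval₂ i γ (iterPQ p q d n).2 = 0) := by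
  induction n with
  | zero => simp [iterPQ]
  | succ n ih =>
    simp only [iterPQ]
    by_cases hB : eval₂ i γ (iterPQ p q d n).2 = 0
    · rw [wr_homEval_zero i p d _ _ _ hB, wr_homEval_zero i q d _ _ _ hB]
      have hA : (eval₂ i γ (iterPQ p q d n).1) ^ d ≠ 0 := pow_ne_zero _ fun h => ih ⟨h, hB⟩
      have := wr_lead p q d hd hdeg
      simpa [hA] using this
    · rw [wr_homEval i p d (by omega) _ _ _ hB, wr_homEval i q d (by omega) _ _ _ hB]
      have hB' := pow_ne_zero d hB
      have := wr_cop i p q hcop (eval₂ i γ (iterPQ p q d n).1 / eval₂ i γ (iterPQ p q d n).2)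
      simpa [hB, hB'] using this

lemma wr_map_phi {k L : Type*} [Field k] [Field L] (p q : k[X]) (d n : ℕ)
    (ψ : RatFunc k →+* L) (γ : L) :
    eval₂ ψ γ (phiIterMinusT p q d n) =
      eval₂ (ψ.comp (algebraMap k (RatFunc k))) γ (iterPQ p q d n).1 -
      ψ RatFunc.X * eval₂ (ψ.comp (algebraMap k (RatFunc k))) γ (iterPQ p q d n).2 := by
  rw [phiIterMinusT, eval₂_sub, eval₂_mul, eval₂_C, eval₂_map, eval₂_map]

/-- `c = X e` forces `c = e = 0`. -/
lemma wr_lin {k : Type*} [Field k] (a b : k)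
    (h : algebraMap k (RatFunc k) a - RatFunc.X * algebraMap k (RatFunc k) b = 0) :
    a = 0 ∧ b = 0 := by
  have h1 : algebraMap k[X] (RatFunc k) (C a - X * C b) = 0 := by
    rw [map_sub, map_mul, RatFunc.algebraMap_X, RatFunc.algebraMap_C, RatFunc.algebraMap_C]
    exact h
  have h2 : C a - X * C b = 0 := by
    apply RatFunc.algebraMap_injective k; rw [h1, map_zero]
  have c0 := congrArg (fun f => coeff f 0) h2
  have c1 := congrArg (fun f => coeff f 1) h2
  simp [coeff_C] at c0 c1
  exact ⟨c0, c1⟩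

lemma wr_phi_ne {k : Type*} [Field k] (p q : k[X]) (d : ℕ)
    (hd : 2 ≤ d) (hcop : IsCoprime p q) (hdeg : max p.natDegree q.natDegree = d) (n : ℕ) :
    phiIterMinusT p q d n ≠ 0 := by
  intro h0
  have h := wr_map_phi p q d n (RingHom.id _) 0
  rw [h0, eval₂_zero, RingHom.id_comp] at h
  have key : ∀ r : k[X], eval₂ (algebraMap k (RatFunc k)) 0 r
      = algebraMap k (RatFunc k) (eval₂ (RingHom.id k) 0 r) := by
    intro r
    rw [hom_eval₂]; simp
  rw [key, key] at h
  exact wr_iter_cop (RingHom.id k) p q d hd hcop hdeg n 0 (wr_lin _ _ h.symm)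

/-- roots of the `n+1`-st iterate lie above roots of the first. -/
lemma wr_root_step {k L : Type*} [Field k] [Field L] (p q : k[X]) (d : ℕ)
    (hd : 2 ≤ d) (hcop : IsCoprime p q) (hdeg : max p.natDegree q.natDegree = d) (n : ℕ)
    (ψ : RatFunc k →+* L) (γ : L) (h : eval₂ ψ γ (phiIterMinusT p q d (n+1)) = 0) :
    ∃ β : L, eval₂ ψ β (phiIterMinusT p q d 1) = 0 ∧
      eval₂ (ψ.comp (algebraMap k (RatFunc k))) γ (iterPQ p q d n).1 -
      β * eval₂ (ψ.comp (algebraMap k (RatFunc k))) γ (iterPQ p q d n).2 = 0 := by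
  rw [wr_map_phi] at h
  set i := ψ.comp (algebraMap k (RatFunc k)) with hi
  simp only [iterPQ] at h
  by_cases hB : eval₂ i γ (iterPQ p q d n).2 = 0
  · exfalso
    rw [wr_homEval_zero i p d _ _ _ hB, wr_homEval_zero i q d _ _ _ hB, ← mul_assoc,
      ← sub_mul] at h
    have hA : (eval₂ i γ (iterPQ p q d n).1) ^ d ≠ 0 :=
      pow_ne_zero _ fun h => wr_iter_cop i p q d hd hcop hdeg n γ ⟨h, hB⟩
    have h' := (mul_eq_zero.1 h).resolve_right hA
    apply wr_lead p q d hd hdeg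
    apply wr_lin
    apply ψ.injective
    rw [map_zero, ← h', map_sub, map_mul]; rfl
  · refine ⟨eval₂ i γ (iterPQ p q d n).1 / eval₂ i γ (iterPQ p q d n).2, ?_, by field_simp; simp⟩
    rw [wr_homEval i p d (by omega) _ _ _ hB, wr_homEval i q d (by omega) _ _ _ hB] at h
    rw [wr_map_phi]
    simp only [iterPQ]
    rw [← hi]
    rw [wr_homEval i p d (by omega) _ _ _ (by simp), wr_homEval i q d (by omega) _ _ _ (by simp)]
    have hB' := pow_ne_zero d hB
    simp only [eval₂_X, eval₂_one, one_pow, one_mul, div_one]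
    refine (mul_eq_zero.1 ?_).resolve_left hB'
    rw [← h]; ring

/-- The specialization `t ↦ β`. -/
lemma wr_spec {k L : Type*} [Field k] [Field L] (p q : k[X]) (d : ℕ)
    (hd : 2 ≤ d) (hcop : IsCoprime p q) (hdeg : max p.natDegree q.natDegree = d)
    (ψ : RatFunc k →+* L) (β : L) (h : eval₂ ψ β (phiIterMinusT p q d 1) = 0) :
    ∃ φ : RatFunc k →+* L, φ RatFunc.X = β ∧
      φ.comp (algebraMap k (RatFunc k)) = ψ.comp (algebraMap k (RatFunc k)) := by
  let _ : Algebra (RatFunc k) L := ψ.toAlgebra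
  let _ : Algebra k L := (ψ.comp (algebraMap k (RatFunc k))).toAlgebra
  have : IsScalarTower k (RatFunc k) L := IsScalarTower.of_algebraMap_eq fun _ => rfl
  have htr : Transcendental k β := by
    intro halg
    rw [wr_map_phi] at h
    have hc := wr_iter_cop (algebraMap k L) p q d hd hcop hdeg 1 β
    change aeval β (iterPQ p q d 1).1 -
      algebraMap (RatFunc k) L (RatFunc.X : RatFunc k) * aeval β (iterPQ p q d 1).2 = 0 at h
    change ¬ (aeval β (iterPQ p q d 1).1 = 0 ∧ aeval β (iterPQ p q d 1).2 = 0) at hc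
    have hq : aeval β (iterPQ p q d 1).2 ≠ 0 := by
      intro hq
      rw [hq] at h hc
      simp at h; simp [h] at hc
    have hX : algebraMap (RatFunc k) L (RatFunc.X : RatFunc k) =
        aeval β (iterPQ p q d 1).1 * (aeval β (iterPQ p q d 1).2)⁻¹ := by
      rw [sub_eq_zero] at h
      rw [h]; field_simp
    have hal : ∀ r : k[X], IsAlgebraic k (aeval β r) := fun r => by
      have hi : IsIntegral k β := isAlgebraic_iff_isIntegral.1 halg
      have hle : Algebra.adjoin k {β} ≤ integralClosure k L :=
        Algebra.adjoin_le (Set.singleton_subset_iff.2 hi)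
      exact IsIntegral.isAlgebraic (hle (aeval_mem_adjoin_singleton k β))
    have : IsAlgebraic k (algebraMap (RatFunc k) L (RatFunc.X : RatFunc k)) := by
      rw [hX]; exact (hal _).mul (hal _).inv
    rw [isAlgebraic_algebraMap_iff (algebraMap (RatFunc k) L).injective] at this
    exact RatFunc.transcendental_X this
  refine ⟨((IntermediateField.val _).comp
    (RatFunc.algEquivOfTranscendental β htr).toAlgHom).toRingHom, ?_, ?_⟩
  · simp
  · ext c
    exact AlgHom.commutes ((IntermediateField.val _).comp
      (RatFunc.algEquivOfTranscendental β htr).toAlgHom) c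

lemma wr_not_F {k S : Type*} [Field k] [Field S] [Algebra (RatFunc k) S] (x : S)
    (hx : x ∉ Set.range ((algebraMap (RatFunc k) S).comp (algebraMap k (RatFunc k))))
    (g : k[X]) (hg : g ≠ 0)
    (hgx : eval₂ ((algebraMap (RatFunc k) S).comp (algebraMap k (RatFunc k))) x g = 0) :
    x ∉ Set.range (algebraMap (RatFunc k) S) := by
  rintro ⟨y, rfl⟩
  have : IsAlgebraic k y := by
    refine ⟨g, hg, ?_⟩
    rw [← hom_eval₂] at hgx
    simpa [aeval_def] using hgx
  by_cases hc : ∃ c, y = RatFunc.C c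
  · obtain ⟨c, rfl⟩ := hc
    exact hx ⟨c, rfl⟩
  · exact RatFunc.transcendental_of_ne_C _ hc this

lemma wr_minpoly {k S : Type*} [Field k] [Field S] [Algebra (RatFunc k) S] (x : S)
    (g : k[X]) (hg : g ≠ 0)
    (hgx : eval₂ ((algebraMap (RatFunc k) S).comp (algebraMap k (RatFunc k))) x g = 0) :
    ∃ m : k[X], minpoly (RatFunc k) x = m.map (algebraMap k (RatFunc k)) := by
  have hg' : (g * C (g.leadingCoeff)⁻¹).Monic := monic_mul_leadingCoeff_inv hg
  have hdvd : minpoly (RatFunc k) x ∣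
      (g * C (g.leadingCoeff)⁻¹).map (algebraMap k (RatFunc k)) := by
    apply minpoly.dvd
    rw [aeval_def, eval₂_map, eval₂_mul, hgx, zero_mul]
  have hint : IsIntegral (RatFunc k) x := by
    refine ⟨_, hg'.map (algebraMap k (RatFunc k)), ?_⟩
    rw [eval₂_map, eval₂_mul, hgx, zero_mul]
  have := integralClosure.mem_lifts_of_monic_of_dvd_map (RatFunc k) hg' (minpoly.monic hint) hdvd
  rw [lifts_iff_coeff_lifts] at this
  have h2 : minpoly (RatFunc k) x ∈ lifts (algebraMap k (RatFunc k)) := by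
    rw [lifts_iff_coeff_lifts]
    intro n
    obtain ⟨⟨y, hy⟩, hy'⟩ := this n
    have hy2 : IsAlgebraic k y := IsIntegral.isAlgebraic hy
    by_cases hc : ∃ c, y = RatFunc.C c
    · obtain ⟨c, rfl⟩ := hc
      exact ⟨c, hy'⟩
    · exact absurd hy2 (RatFunc.transcendental_of_ne_C _ hc)
  obtain ⟨m, hm⟩ := h2
  exact ⟨m, hm.symm⟩

lemma wr_natDegree {k : Type*} [Field k] (p q : k[X]) (d : ℕ) :
    (phiIterMinusT p q d 1).natDegree ≤ d := by
  have h : ∀ r : k[X], (homEvalPoly r d X 1).natDegree ≤ d := by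
    intro r
    refine natDegree_sum_le_of_forall_le _ _ fun j hj => ?_
    have hj' : j ≤ d := Nat.lt_succ_iff.1 (Finset.mem_range.1 hj)
    simp only [one_pow, mul_one]
    exact (natDegree_C_mul_X_pow_le _ _).trans hj'
  rw [phiIterMinusT]
  refine (natDegree_sub_le _ _).trans (max_le ?_ ?_)
  · exact natDegree_map_le.trans (h p)
  · exact (natDegree_C_mul_le _ _).trans (natDegree_map_le.trans (h q))

lemma wr_step {k : Type*} [Field k] [CharZero k]
    (p q : k[X]) (d : ℕ) (hd : 2 ≤ d)
    (hcop : IsCoprime p q) (hdeg : max p.natDegree q.natDegree = d) (n c : ℕ) (hc : 1 ≤ c)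
    (hb : ∀ φ : RatFunc k →+* (phiIterMinusT p q d 1).SplittingField,
      φ.comp (algebraMap k (RatFunc k)) = (algebraMap (RatFunc k)
        (phiIterMinusT p q d 1).SplittingField).comp (algebraMap k (RatFunc k)) →
      Nat.card ((phiIterMinusT p q d n).map φ).Gal ≤ c) :
    Nat.card (phiIterMinusT p q d (n + 1)).Gal ≤ Nat.card (phiIterMinusT p q d 1).Gal * c ^ d := by
  classical
  have : CharZero (RatFunc k) := charZero_of_injective_algebraMap (algebraMap k (RatFunc k)).injective
  have hP1 := wr_phi_ne p q d hd hcop hdeg 1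
  have hPn := wr_phi_ne p q d hd hcop hdeg n
  have hD := wr_natDegree p q d
  rw [wr_card_gal (phiIterMinusT p q d 1)]
  set P1 := phiIterMinusT p q d 1 with hP1def
  have : CharZero P1.SplittingField :=
    charZero_of_injective_algebraMap (algebraMap (RatFunc k) P1.SplittingField).injective
  set a := algebraMap (RatFunc k) P1.SplittingField with ha
  have hch : ∀ β : P1.SplittingField, ∃ φ : RatFunc k →+* P1.SplittingField,
      φ.comp (algebraMap k (RatFunc k)) = a.comp (algebraMap k (RatFunc k)) ∧
      (eval₂ a β P1 = 0 → φ RatFunc.X = β) := by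
    intro β
    by_cases h : eval₂ a β P1 = 0
    · obtain ⟨φ, h1, h2⟩ := wr_spec p q d hd hcop hdeg a β h
      exact ⟨φ, h2, fun _ => h1⟩
    · exact ⟨a, rfl, fun h' => absurd h' h⟩
  choose φ hφ1 hφ2 using hch
  set s := (P1.map a).roots.toFinset with hs
  set Q := ∏ β ∈ s, (phiIterMinusT p q d n).map (φ β) with hQ
  have hQ0 : Q ≠ 0 := Finset.prod_ne_zero_iff.2 fun β _ =>
    (Polynomial.map_ne_zero_iff (φ β).injective).2 hPn
  have hcard : s.card ≤ d :=
    (Multiset.toFinset_card_le _).trans ((card_roots' _).trans (natDegree_map_le.trans hD))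
  refine (wr_gal_tower (phiIterMinusT p q d (n + 1)) Q hQ0 ?_).trans ?_
  · intro γ hγ
    set j := (algebraMap Q.SplittingField (AlgebraicClosure Q.SplittingField)).comp
      (algebraMap P1.SplittingField Q.SplittingField) with hj
    have hja : algebraMap (RatFunc k) (AlgebraicClosure Q.SplittingField) = j.comp a := by
      rw [IsScalarTower.algebraMap_eq (RatFunc k) Q.SplittingField (AlgebraicClosure Q.SplittingField),
        IsScalarTower.algebraMap_eq (RatFunc k) P1.SplittingField Q.SplittingField]
      rfl
    rw [aeval_def, hja] at hγ
    obtain ⟨β', h1, h2⟩ := wr_root_step p q d hd hcop hdeg n _ γ hγ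
    have hr : ((P1.map a).map j).IsRoot β' := by
      rw [IsRoot, Polynomial.map_map, eval_map]; exact h1
    obtain ⟨β, rfl⟩ := (SplittingField.splits P1).mem_range_of_isRoot
      ((Polynomial.map_ne_zero_iff a.injective).2 hP1) hr
    have hβ : eval₂ a β P1 = 0 := by
      apply j.injective
      rw [hom_eval₂, map_zero]; exact h1
    have hmem : β ∈ s := by
      rw [hs, Multiset.mem_toFinset, mem_roots ((Polynomial.map_ne_zero_iff a.injective).2 hP1),
        IsRoot, eval_map]
      exact hβ
    refine eval₂_eq_zero_of_dvd_of_eval₂_eq_zero j γ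
      (Finset.dvd_prod_of_mem (fun β => (phiIterMinusT p q d n).map (φ β)) hmem) ?_
    rw [eval₂_map, wr_map_phi, RingHom.comp_assoc, hφ1, RingHom.comp_apply, hφ2 β hβ,
      ← RingHom.comp_assoc]
    exact h2
  · refine Nat.mul_le_mul_left _ ?_
    calc Nat.card Q.Gal ≤ ∏ β ∈ s, Nat.card ((phiIterMinusT p q d n).map (φ β)).Gal :=
          wr_gal_prod_le _ _
      _ ≤ ∏ β ∈ s, c := Finset.prod_le_prod' fun β _ => hb _ (hφ1 β)
      _ = c ^ s.card := by simp
      _ ≤ c ^ d := Nat.pow_le_pow_right hc hcard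

lemma wr_exp (d n : ℕ) (hd : 2 ≤ d) :
    (d ^ (n + 1) - 1) / (d - 1) = 1 + d * ((d ^ n - 1) / (d - 1)) := by
  rw [← Nat.geomSum_eq hd, ← Nat.geomSum_eq hd, Finset.sum_range_succ', Finset.mul_sum]
  simp only [pow_succ']
  simp [add_comm]

/-- Let `φ = p/q` of degree `d ≥ 2` over a field `k` of characteristic
zero with `φ′ ≠ 0`, let `K_n` be a splitting field of `p_n(x) − t q_n(x)` over `k(t)`
and `H = Gal(K₁/k(t))`.  If `k` is not algebraically closed in `K₁`, then for every
`n ≥ 2` the order of `Gal(K_n/k(t))` is strictly smaller than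
`(#H)^{(dⁿ−1)/(d−1)}`, the order of the `n`-fold wreath product `[H]ⁿ`. -/
theorem gal_lt_wreath_of_not_alg_closed {k : Type*} [Field k] [CharZero k]
    (p q : Polynomial k) (d : ℕ) (hd : 2 ≤ d)
    (hcop : IsCoprime p q) (hdeg : max p.natDegree q.natDegree = d)
    (hW : derivative p * q - p * derivative q ≠ 0)
    (hnotclosed : ∃ x : (phiIterMinusT p q d 1).SplittingField,
      x ∉ Set.range ((algebraMap (RatFunc k) (phiIterMinusT p q d 1).SplittingField).comp
        (algebraMap k (RatFunc k))) ∧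
      ∃ g : Polynomial k, g ≠ 0 ∧
        Polynomial.eval₂
          ((algebraMap (RatFunc k) (phiIterMinusT p q d 1).SplittingField).comp
            (algebraMap k (RatFunc k))) x g = 0) :
    ∀ n : ℕ, 2 ≤ n →
      Nat.card (phiIterMinusT p q d n).Gal <
        (Nat.card (phiIterMinusT p q d 1).Gal) ^ ((d ^ n - 1) / (d - 1)) := by
  obtain ⟨x, hx, g, hg, hgx⟩ := hnotclosed
  have : CharZero (RatFunc k) :=
    charZero_of_injective_algebraMap (algebraMap k (RatFunc k)).injective
  have hxF := wr_not_F x hx g hg hgx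
  obtain ⟨m, hm⟩ := wr_minpoly x g hg hgx
  have hnorm : Normal (RatFunc k) (phiIterMinusT p q d 1).SplittingField :=
    Normal.of_isSplittingField (phiIterMinusT p q d 1)
  have hsplit := hnorm.splits x
  have hlt : ∀ φ : RatFunc k →+* (phiIterMinusT p q d 1).SplittingField,
      φ.comp (algebraMap k (RatFunc k)) = (algebraMap (RatFunc k)
        (phiIterMinusT p q d 1).SplittingField).comp (algebraMap k (RatFunc k)) →
      Nat.card ((phiIterMinusT p q d 1).map φ).Gal < Nat.card (phiIterMinusT p q d 1).Gal := by
    intro φ hφ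
    refine wr_gal_map_lt φ _ (wr_phi_ne p q d hd hcop hdeg 1) x hxF ?_
    rw [hm, Polynomial.map_map] at hsplit ⊢
    rwa [hφ]
  have hH : 2 ≤ Nat.card (phiIterMinusT p q d 1).Gal := by
    have h1 := hlt _ rfl
    have : CharZero (phiIterMinusT p q d 1).SplittingField :=
      charZero_of_injective_algebraMap
        (algebraMap (RatFunc k) (phiIterMinusT p q d 1).SplittingField).injective
    have h2 := wr_gal_pos ((phiIterMinusT p q d 1).map
      (algebraMap (RatFunc k) (phiIterMinusT p q d 1).SplittingField))
    omega
  have hd0 : d ≠ 0 := by omega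
  intro n hn
  induction n, hn using Nat.le_induction with
  | base =>
    have h := wr_step p q d hd hcop hdeg 1 (Nat.card (phiIterMinusT p q d 1).Gal - 1) (by omega)
      (fun φ hφ => Nat.le_sub_one_of_lt (hlt φ hφ))
    have he : (d ^ 2 - 1) / (d - 1) = 1 + d := by
      have h1 : (d - 1) / (d - 1) = 1 := Nat.div_self (by omega)
      have := wr_exp d 1 hd
      rw [pow_one, h1] at this
      simpa using this
    rw [he, pow_add, pow_one]
    refine h.trans_lt (Nat.mul_lt_mul_of_pos_left ?_ (by omega))
    exact Nat.pow_lt_pow_left (by omega) hd0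
  | succ n hn ih =>
    have h := wr_step p q d hd hcop hdeg n (Nat.card (phiIterMinusT p q d n).Gal)
      (wr_gal_pos _) (fun φ _ => wr_gal_map_le φ _ (wr_phi_ne p q d hd hcop hdeg n))
    rw [wr_exp d n hd, pow_add, pow_one, mul_comm d, pow_mul]
    refine h.trans_lt (Nat.mul_lt_mul_of_pos_left ?_ (by omega))
    exact Nat.pow_lt_pow_left ih hd0
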